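/- Let c, b > 0 with rc > (b+1)(b-c) and set a = c/√((1+b)(c-b)+rc). With λ₂ = -b and λ₁ = -(c-1)/2 + (1/2)√((2b+1-c)² + a²((b+1)x/c + y)² + (az - 2b/a)²), the inequality 2(λ₁ - λ₂) ≥ 2b + 1 - c + |2b + 1 - c| ≥ 0 holds for all (x,y,z) ∈ ℝ³; in particular λ₁ ≥ λ₂. -/

import Mathlib

/-- The ordering λ₁ ≥ λ₂ of the eigenvalues of the symmetrized transformed
Jacobian: 2(λ₁ - λ₂) ≥ 2b + 1 - c + |2b + 1 - c| ≥ 0. -/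
theorem eigenvalue_ordering
    (c b r : ℝ) (hc : 0 < c) (hb : 0 < b) (hr : 0 < r)
    (hcond : (b + 1) * (b - c) < r * c)
    (a : ℝ) (ha : a = c / Real.sqrt ((1 + b) * (c - b) + r * c)) :
    ∀ x y z : ℝ,
      (2 * b + 1 - c + |2 * b + 1 - c| ≤
        2 * ((-(c - 1) / 2 + (1 / 2) * Real.sqrt ((2 * b + 1 - c) ^ 2 +
          a ^ 2 * ((b + 1) / c * x + y) ^ 2 + (a * z - 2 * b / a) ^ 2)) - (-b)) ∧
       (0 : ℝ) ≤ 2 * b + 1 - c + |2 * b + 1 - c|) ∧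
      -b ≤ -(c - 1) / 2 + (1 / 2) * Real.sqrt ((2 * b + 1 - c) ^ 2 +
        a ^ 2 * ((b + 1) / c * x + y) ^ 2 + (a * z - 2 * b / a) ^ 2) := by
  intro x y z
  have hsqrt : |2 * b + 1 - c| ≤ Real.sqrt ((2 * b + 1 - c) ^ 2 +
      a ^ 2 * ((b + 1) / c * x + y) ^ 2 + (a * z - 2 * b / a) ^ 2) := by
    apply Real.abs_le_sqrt
    have : 0 ≤ a ^ 2 * ((b + 1) / c * x + y) ^ 2 := by positivity
    linarith [sq_nonneg (a * z - 2 * b / a)]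
  have habs := neg_abs_le (2 * b + 1 - c)
  exact ⟨⟨by linarith, by linarith⟩, by linarith⟩
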